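/- For every integer $n \ge 2$, $e_2(n) \le n \lceil \log_2 n \rceil - (\lfloor \log_2 n \rfloor - 1)^2$; that is, there exists a graph $G$ of order $n$ with rainbow connection number $2$ and at most $n \lceil \log_2 n \rceil - (\lfloor \log_2 n \rfloor - 1)^2$ edges. -/

import Mathlib

open SimpleGraph

/-- An edge-coloring `c` of `G` is rainbow (for connectivity) if every two distinct
vertices are joined by a path whose edges receive pairwise distinct colors. -/
def IsRainbowEdgeColoring {V : Type*} (G : SimpleGraph V) {α : Type*} (c : Sym2 V → α) : Prop :=
  ∀ u v : V, u ≠ v → ∃ p : G.Walk u v, p.IsPath ∧ (p.edges.map c).Nodup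

/-- The rainbow connection number of `G`: the least `k` admitting a `k`-rainbow
edge-coloring. -/
noncomputable def rainbowConnNum {V : Type*} (G : SimpleGraph V) : ℕ :=
  sInf {k | ∃ c : Sym2 V → Fin k, IsRainbowEdgeColoring G c}

/-- `e₂(n)`: the minimum number of edges of a graph of order `n` with rainbow
connection number `2`. -/
noncomputable def e2 (n : ℕ) : ℕ :=
  sInf {m | ∃ G : SimpleGraph (Fin n), rainbowConnNum G = 2 ∧ G.edgeSet.ncard = m}

theorem IsRainbowEdgeColoring.of_iso {V W α : Type*} {G : SimpleGraph V} {H : SimpleGraph W}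
    (e : G ≃g H) {c : Sym2 V → α} (hc : IsRainbowEdgeColoring G c) :
    IsRainbowEdgeColoring H (c ∘ Sym2.map e.symm) := by
  intro u v huv
  obtain ⟨u, rfl⟩ := e.surjective u
  obtain ⟨v, rfl⟩ := e.surjective v
  obtain ⟨p, hp, hcol⟩ := hc u v (fun h => huv (congrArg e h))
  refine ⟨p.map e.toHom, hp.map e.injective, ?_⟩
  have hcomp : (c ∘ Sym2.map e.symm) ∘ Sym2.map e.toHom = c := by
    funext s
    induction s with
    | _ x y => simp
  rw [Walk.edges_map, List.map_map, hcomp]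
  exact hcol

theorem rainbowConnNum_congr {V W : Type*} {G : SimpleGraph V} {H : SimpleGraph W}
    (e : G ≃g H) : rainbowConnNum G = rainbowConnNum H := by
  unfold rainbowConnNum
  congr 1
  ext k
  exact ⟨fun ⟨_, hc⟩ => ⟨_, hc.of_iso e⟩, fun ⟨_, hc⟩ => ⟨_, hc.of_iso e.symm⟩⟩

theorem exists_rainbow_path_of_adj_adj {V α : Type*} {G : SimpleGraph V} {c : Sym2 V → α}
    {u v w : V} (huv : u ≠ v) (huw : G.Adj u w) (hwv : G.Adj w v) (hc : c s(u, w) ≠ c s(w, v)) :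
    ∃ p : G.Walk u v, p.IsPath ∧ (p.edges.map c).Nodup :=
  ⟨.cons huw (.cons hwv .nil), by simp [huw.ne, hwv.ne, huv], by simpa using hc⟩

theorem two_le_rainbowConnNum {V : Type*} {G : SimpleGraph V} {u v : V} (huv : u ≠ v)
    (hadj : ¬ G.Adj u v) {k : ℕ} {c : Sym2 V → Fin k} (hc : IsRainbowEdgeColoring G c) :
    2 ≤ k := by
  obtain ⟨p, -, hcol⟩ := hc u v huv
  have hlen : p.length ≤ k := by simpa using hcol.length_le_card
  by_contra! hk
  match p, hlen with
  | .nil, _ => exact huv rfl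
  | .cons h .nil, _ => exact hadj h
  | .cons _ (.cons _ _), hlen => simp only [Walk.length_cons] at hlen; omega

/-- The vertices on the right are sets of vertices on the left; the edge joining `i` to `T` is
colored according to whether `i ∈ T`. -/
theorem rainbowConnNum_completeBipartiteGraph_eq_two {ι : Type*} [Nontrivial ι]
    {S : Set (Finset ι)} (hS : ∀ i j : ι, i ≠ j → ∃ T ∈ S, ¬ (i ∈ T ↔ j ∈ T)) :
    rainbowConnNum (completeBipartiteGraph ι S) = 2 := by
  classical
  let c : Sym2 (ι ⊕ S) → Fin 2 := fun s =>
    if ∃ (i : ι) (T : S), s = s(Sum.inl i, Sum.inr T) ∧ i ∈ T.1 then 1 else 0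
  have hcval (i : ι) (T : S) : c s(Sum.inl i, Sum.inr T) = if i ∈ T.1 then 1 else 0 := by
    have hiff : (∃ (j : ι) (U : S),
        s((Sum.inl i : ι ⊕ S), Sum.inr T) = s(Sum.inl j, Sum.inr U) ∧ j ∈ U.1) ↔ i ∈ T.1 := by
      constructor
      · rintro ⟨j, U, h, hj⟩
        simp only [Sym2.eq_iff, Sum.inl.injEq, Sum.inr.injEq, reduceCtorEq, and_self,
          or_false] at h
        rwa [h.1, h.2]
      · exact fun h => ⟨i, T, rfl, h⟩
    simp only [c, hiff]
  have hcval' (i : ι) (T : S) : c s(Sum.inr T, Sum.inl i) = if i ∈ T.1 then 1 else 0 := by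
    rw [Sym2.eq_swap, hcval]
  have hc : IsRainbowEdgeColoring (completeBipartiteGraph ι S) c := by
    rintro (i | T) (j | U) huv
    · obtain ⟨T, hT, hne⟩ := hS i j (fun h => huv (congrArg _ h))
      refine exists_rainbow_path_of_adj_adj (w := Sum.inr ⟨T, hT⟩) huv (by simp) (by simp) ?_
      rw [hcval, hcval']
      split_ifs <;> simp_all
    · exact ⟨.cons (by simp) .nil, by simp, by simp⟩
    · exact ⟨.cons (by simp) .nil, by simp, by simp⟩
    · have hTU : T.1 ≠ U.1 := fun h => huv (congrArg _ (Subtype.ext h))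
      obtain ⟨i, hi⟩ : ∃ i, ¬ (i ∈ T.1 ↔ i ∈ U.1) := by
        by_contra! h
        exact hTU (Finset.ext h)
      refine exists_rainbow_path_of_adj_adj (w := Sum.inl i) huv (by simp) (by simp) ?_
      rw [hcval, hcval']
      split_ifs <;> simp_all
  obtain ⟨i, j, hij⟩ := exists_pair_ne ι
  refine le_antisymm (Nat.sInf_le ⟨c, hc⟩) (le_csInf ⟨2, c, hc⟩ ?_)
  rintro k ⟨d, hd⟩
  exact two_le_rainbowConnNum (u := Sum.inl i) (v := Sum.inl j) (by simpa using hij) (by simp) hd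

theorem e2_le_mul {n k : ℕ} (hk : 2 ≤ k) (hkn : 2 * k - 1 ≤ n) (hn : n ≤ 2 ^ k) :
    e2 n ≤ k * (n - k) := by
  classical
  have : NeZero k := ⟨by omega⟩
  have : Nontrivial (Fin k) := Fin.nontrivial_iff_two_le.mpr hk
  let A : Finset (Finset (Fin k)) := (Finset.univ.erase 0).image ({·})
  have hA : A.card ≤ n - k := by
    refine Finset.card_image_le.trans ?_
    rw [Finset.card_erase_of_mem (Finset.mem_univ _), Finset.card_fin]
    omega
  obtain ⟨S, hAS, -, hScard⟩ := Finset.exists_subsuperset_card_eq (Finset.subset_univ A) hA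
    (by rw [Finset.card_univ, Fintype.card_finset, Fintype.card_fin]; omega)
  have hmem {i : Fin k} (hi : i ≠ 0) : {i} ∈ S :=
    hAS (Finset.mem_image_of_mem _ (Finset.mem_erase.mpr ⟨hi, Finset.mem_univ i⟩))
  have hrc : rainbowConnNum (completeBipartiteGraph (Fin k) (S : Set (Finset (Fin k)))) = 2 := by
    refine rainbowConnNum_completeBipartiteGraph_eq_two fun i j hij => ?_
    by_cases hi : i = 0
    · exact ⟨{j}, hmem (fun hj => hij (hi.trans hj.symm)), by simpa using hij⟩
    · exact ⟨{i}, hmem hi, by simpa using hij.symm⟩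
  have e : Fin k ⊕ (S : Set (Finset (Fin k))) ≃ Fin n :=
    Fintype.equivFinOfCardEq (by simp [hScard]; omega)
  let f := Iso.map e (completeBipartiteGraph (Fin k) (S : Set (Finset (Fin k))))
  refine Nat.sInf_le ⟨_, (rainbowConnNum_congr f).symm.trans hrc, ?_⟩
  rw [← Nat.card_coe_set_eq, ← Nat.card_congr f.mapEdgeSet, Nat.card_coe_set_eq, Set.ncard,
    encard_edgeSet_completeBipartiteGraph, ← hScard]
  simp

theorem e2_le_choose_two (n : ℕ) : e2 n ≤ n.choose 2 := by
  classical
  unfold e2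
  set M := {m | ∃ G : SimpleGraph (Fin n), rainbowConnNum G = 2 ∧ G.edgeSet.ncard = m}
  obtain hM | hM := M.eq_empty_or_nonempty
  · simp [hM]
  · obtain ⟨G, -, hG⟩ := Nat.sInf_mem hM
    rw [← hG, ← coe_edgeFinset, Set.ncard_coe_finset]
    simpa using G.card_edgeFinset_le_card_choose_two

theorem two_mul_sub_one_le_two_pow_pred_add_one {k : ℕ} (hk : 1 ≤ k) :
    2 * k - 1 ≤ 2 ^ (k - 1) + 1 := by
  obtain ⟨j, rfl⟩ := Nat.exists_eq_add_of_le' hk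
  induction j with
  | zero => simp
  | succ j ih =>
    have := ih (by omega)
    have hj := Nat.one_le_two_pow (n := j)
    rcases j with _ | j
    · simp
    · simp only [Nat.add_sub_cancel, pow_succ] at *
      omega

theorem e2_upper_bound (n : ℕ) (hn : 2 ≤ n) :
    (e2 n : ℝ) ≤ n * (⌈Real.logb 2 n⌉ : ℝ) - ((⌊Real.logb 2 n⌋ : ℝ) - 1) ^ 2 := by
  have hceil : ⌈Real.logb 2 n⌉ = (Nat.clog 2 n : ℤ) := by
    have := Real.ceil_logb_natCast (b := 2) (r := (n : ℝ)) n.cast_nonneg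
    simpa using this
  have hfloor : ⌊Real.logb 2 n⌋ = (Nat.log 2 n : ℤ) := by
    have := Real.floor_logb_natCast (b := 2) (r := (n : ℝ)) n.cast_nonneg
    simpa using this
  rw [hceil, hfloor, Int.cast_natCast, Int.cast_natCast]
  obtain rfl | hn3 : n = 2 ∨ 3 ≤ n := by omega
  · have h : (e2 2 : ℝ) ≤ 1 := mod_cast e2_le_choose_two 2
    rw [Nat.clog_eq_one le_rfl le_rfl, (by decide : Nat.log 2 2 = 1)]
    norm_num
    exact_mod_cast h.trans one_le_two
  · have hlog : 1 ≤ Nat.log 2 n := Nat.log_pos (by norm_num) hn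
    have hle : Nat.log 2 n ≤ Nat.clog 2 n := Nat.log_le_clog 2 n
    have hlt : 2 ^ (Nat.clog 2 n - 1) < n := Nat.pow_pred_clog_lt_self (by norm_num) (by omega)
    have hclog : 2 ≤ Nat.clog 2 n := (Nat.lt_clog_iff_pow_lt (by norm_num)).mpr (by omega)
    have hkn := two_mul_sub_one_le_two_pow_pred_add_one (k := Nat.clog 2 n) (by omega)
    have he := e2_le_mul hclog (by omega) (Nat.le_pow_clog (by norm_num) n)
    have he' : (e2 n : ℝ) ≤ Nat.clog 2 n * (n - Nat.clog 2 n) := by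
      rw [← Nat.cast_sub (by omega)]
      exact_mod_cast he
    have hlog' : (1 : ℝ) ≤ Nat.log 2 n := mod_cast hlog
    have hle' : (Nat.log 2 n : ℝ) ≤ Nat.clog 2 n := mod_cast hle
    nlinarith
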